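/- Let T be a Y(2|1) T-family in A, let E be a right A-module with lowest weight covector Ω†, let a ≥ 1, b ≥ 0, and let ū = (u₁,…,u_a), v̄ = (v₁,…,v_b) have admissible concatenation. Then the dual Bethe vector Ψ_{a,b}(ū,v̄) satisfies Ψ_{a,b}(ū,v̄) = Ψ_{a−1,b}(ū_a,v̄)·T₂₁(u_a) + (−1)^{b−1}·Σ_{j=1}^{b} λ₂(vⱼ)·g(vⱼ,u_a)·f(vⱼ,ū_a)·g(v̄ⱼ,vⱼ)·Ψ_{a−1,b−1}(ū_a,v̄ⱼ)·T₃₁(u_a), where ū_a = ū with u_a removed, v̄ⱼ = v̄ with vⱼ removed, f(vⱼ,ū_a) = ∏_{k<a} f(vⱼ,uₖ) and g(v̄ⱼ,vⱼ) = ∏_{k≠j} g(vₖ,vⱼ). -/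

import Mathlib

open scoped BigOperators
open MulOpposite

noncomputable section

namespace Bethe

variable {A : Type*} [Ring A] [Algebra ℂ A]

/-- `g(u,v) = c/(u-v)` -/
def gg (c u v : ℂ) : ℂ := c / (u - v)

/-- `f(u,v) = (u-v+c)/(u-v)` -/
def ff (c u v : ℂ) : ℂ := (u - v + c) / (u - v)

/-- `h(u,v) = (u-v+c)/c` -/
def hh (c u v : ℂ) : ℂ := (u - v + c) / c

/-- A list of parameters is admissible if its entries are pairwise distinct and
`x - y + c ≠ 0` for any two distinct entries `x`, `y`. -/
def Admissible (c : ℂ) (l : List ℂ) : Prop :=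
  l.Pairwise fun x y => x ≠ y ∧ x - y + c ≠ 0 ∧ y - x + c ≠ 0

/-- `∏_{x ∈ xs} ∏_{y ∈ ys} f(x,y)` -/
def prodFF (c : ℂ) (xs ys : List ℂ) : ℂ :=
  (xs.map fun x => (ys.map fun y => ff c x y).prod).prod

/-- `∏_{x ∈ xs} ∏_{y ∈ ys} g(x,y)` -/
def prodGG (c : ℂ) (xs ys : List ℂ) : ℂ :=
  (xs.map fun x => (ys.map fun y => gg c x y).prod).prod

/-- `∏_{x ∈ xs} ∏_{y ∈ ys} h(x,y)` -/
def prodHH (c : ℂ) (xs ys : List ℂ) : ℂ :=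
  (xs.map fun x => (ys.map fun y => hh c x y).prod).prod

/-- `H(w̄) = ∏_{j>k} h(wⱼ,wₖ)` -/
def Hnorm (c : ℂ) : List ℂ → ℂ
  | [] => 1
  | x :: xs => ((xs.map fun y => hh c y x).prod) * Hnorm c xs

/-- `H(w̄*) = ∏_{j<k} h(wⱼ,wₖ)` -/
def HnormRev (c : ℂ) : List ℂ → ℂ
  | [] => 1
  | x :: xs => ((xs.map fun y => hh c x y).prod) * HnormRev c xs

/-- product of `h` over ordered pairs of distinct positions of a list -/
def prodHHne (c : ℂ) (xs : List ℂ) : ℂ :=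
  ∏ j : Fin xs.length, ∏ k : Fin xs.length,
    if j ≠ k then hh c (xs.get j) (xs.get k) else 1

/-- ordered product `T(w₁)⋯T(wₙ)` -/
def Tprod (Tij : ℂ → A) (l : List ℂ) : A := (l.map Tij).prod

/-- normalized ordered product `H(w̄)⁻¹ T(w₁)⋯T(wₙ)` -/
def TT (c : ℂ) (Tij : ℂ → A) (l : List ℂ) : A := (Hnorm c l)⁻¹ • Tprod Tij l

/-- normalized ordered product `H(w̄*)⁻¹ T(w₁)⋯T(wₙ)` -/
def TTrev (c : ℂ) (Tij : ℂ → A) (l : List ℂ) : A := (HnormRev c l)⁻¹ • Tprod Tij l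

/-- The defining (RTT) commutation relations of a super-Yangian `T`-family with
`ℤ₂`-grading `p`. -/
def IsTFam (c : ℂ) {N : ℕ} (p : Fin N → ℕ) (T : Fin N → Fin N → ℂ → A) : Prop :=
  ∀ i j k l : Fin N, ∀ z w : ℂ, z ≠ w →
    T i j z * T k l w - ((-1 : ℂ) ^ ((p i + p j) * (p k + p l))) • (T k l w * T i j z)
      = ((-1 : ℂ) ^ (p l * (p i + p j) + p i * p j) * gg c z w) •
          (T i l z * T k j w - T i l w * T k j z)

/-- the distinguished grading of `gl(2|1)`: `[1]=[2]=0`, `[3]=1` -/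
def p21 : Fin 3 → ℕ := ![0, 0, 1]

/-- the distinguished grading of `gl(1|2)`: `[1]=0`, `[2]=[3]=1` -/
def p12 : Fin 3 → ℕ := ![0, 1, 1]

/-- the sublist of `l` given by the positions in `S`, in the inherited order -/
def sel (l : List ℂ) (S : Finset (Fin l.length)) : List ℂ :=
  (S.sort (· ≤ ·)).map l.get

/-- `λ(w̄) = ∏ⱼ λ(wⱼ)` -/
def lamP (lam2 : ℂ → ℂ) (l : List ℂ) : ℂ := (l.map lam2).prod

/-- The Izergin kernel `K_ℓ(v̄|ū)`. -/
def Kiz (c : ℂ) {ℓ : ℕ} (vs us : Fin ℓ → ℂ) : ℂ :=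
  (∏ j : Fin ℓ, ∏ k : Fin ℓ, if (k : ℕ) < (j : ℕ) then gg c (vs j) (vs k) else 1) *
    (∏ j : Fin ℓ, ∏ k : Fin ℓ, if (k : ℕ) < (j : ℕ) then gg c (us k) (us j) else 1) *
    (∏ j : Fin ℓ, ∏ k : Fin ℓ, hh c (vs j) (us k)) *
    Matrix.det (Matrix.of fun j k => gg c (vs j) (us k) / hh c (vs j) (us k))

/-- The Izergin kernel for lists of equal length (and junk value `0` otherwise). -/
def KizL (c : ℂ) (vs us : List ℂ) : ℂ :=
  if h : vs.length = us.length then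
    Kiz c vs.get fun j => us.get (Fin.cast h j)
  else 0

/-- The operator `X_{a,b}(ū,v̄)` of the paper (`Y(2|1)` case). -/
def X (c : ℂ) (T : Fin 3 → Fin 3 → ℂ → A) (u v : List ℂ) : A :=
  ∑ S : Finset (Fin u.length), ∑ Q : Finset (Fin v.length),
    if S.card = Q.card then
      (prodGG c (sel v Q) (sel u S) * prodFF c (sel u S) (sel u Sᶜ) *
          prodGG c (sel v Qᶜ) (sel v Q) * prodHHne c (sel u S)) •
        (TT c (T 0 2) (sel u S) * Tprod (T 0 1) (sel u Sᶜ) *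
          TT c (T 1 2) (sel v Qᶜ) * Tprod (T 1 1) (sel v Q))
    else 0

/-- The operator `Y_{a,b}(ū,v̄)` of the paper (`Y(2|1)` case). -/
def Y (c : ℂ) (T : Fin 3 → Fin 3 → ℂ → A) (u v : List ℂ) : A :=
  ∑ S : Finset (Fin u.length), ∑ Q : Finset (Fin v.length),
    if S.card = Q.card then
      (KizL c (sel v Q) (sel u S) * prodFF c (sel u S) (sel u Sᶜ) *
          prodGG c (sel v Qᶜ) (sel v Q)) •
        (TT c (T 0 2) (sel v Q) * TT c (T 1 2) (sel v Qᶜ) *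
          Tprod (T 0 1) (sel u Sᶜ) * Tprod (T 1 1) (sel u S))
    else 0

/-- First explicit expression for the `Y(2|1)` Bethe vector (operator part,
the weights `λ₂` included as scalars). -/
def PhiA (c : ℂ) (T : Fin 3 → Fin 3 → ℂ → A) (lam2 : ℂ → ℂ) (u v : List ℂ) : A :=
  ∑ S : Finset (Fin u.length), ∑ Q : Finset (Fin v.length),
    if S.card = Q.card then
      (prodGG c (sel v Q) (sel u S) * prodFF c (sel u S) (sel u Sᶜ) *
          prodGG c (sel v Qᶜ) (sel v Q) * prodHHne c (sel u S) * lamP lam2 (sel v Q)) •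
        (TT c (T 0 2) (sel u S) * Tprod (T 0 1) (sel u Sᶜ) * TT c (T 1 2) (sel v Qᶜ))
    else 0

/-- Second explicit expression for the `Y(2|1)` Bethe vector (operator part). -/
def PhiB (c : ℂ) (T : Fin 3 → Fin 3 → ℂ → A) (lam2 : ℂ → ℂ) (u v : List ℂ) : A :=
  ∑ S : Finset (Fin u.length), ∑ Q : Finset (Fin v.length),
    if S.card = Q.card then
      (KizL c (sel v Q) (sel u S) * prodFF c (sel u S) (sel u Sᶜ) *
          prodGG c (sel v Qᶜ) (sel v Q) * lamP lam2 (sel u S)) •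
        (TT c (T 0 2) (sel v Q) * TT c (T 1 2) (sel v Qᶜ) * Tprod (T 0 1) (sel u Sᶜ))
    else 0

/-- First explicit expression for the `Y(1|2)` Bethe vector, without the overall
sign `(-1)^b` (operator part). -/
def PhiTA (c : ℂ) (T : Fin 3 → Fin 3 → ℂ → A) (lam2 : ℂ → ℂ) (u v : List ℂ) : A :=
  ∑ S : Finset (Fin u.length), ∑ Q : Finset (Fin v.length),
    if S.card = Q.card then
      (prodGG c (sel u S) (sel v Q) * prodFF c (sel v Q) (sel v Qᶜ) *
          prodGG c (sel u Sᶜ) (sel u S) * prodHHne c (sel v Q) * lamP lam2 (sel u S)) •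
        (TT c (T 0 2) (sel v Q) * Tprod (T 1 2) (sel v Qᶜ) * TT c (T 0 1) (sel u Sᶜ))
    else 0

/-- Second explicit expression for the `Y(1|2)` Bethe vector, without the overall
sign `(-1)^b` (operator part). -/
def PhiTB (c : ℂ) (T : Fin 3 → Fin 3 → ℂ → A) (lam2 : ℂ → ℂ) (u v : List ℂ) : A :=
  ∑ S : Finset (Fin u.length), ∑ Q : Finset (Fin v.length),
    if S.card = Q.card then
      (KizL c (sel u S) (sel v Q) * prodFF c (sel v Q) (sel v Qᶜ) *
          prodGG c (sel u Sᶜ) (sel u S) * lamP lam2 (sel v Q)) •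
        (TT c (T 0 2) (sel u S) * TT c (T 0 1) (sel u Sᶜ) * Tprod (T 1 2) (sel v Qᶜ))
    else 0

/-- First explicit expression for the dual `Y(2|1)` Bethe vector, without the
overall sign `(-1)^{b(b-1)/2}`.  `E` is a right `A`-module, i.e. a left
`Aᵐᵒᵖ`-module; `op X • Ωd` is `Ωd · X`. -/
def PsiA {E : Type*} [AddCommGroup E] [Module ℂ E] [Module Aᵐᵒᵖ E]
    (c : ℂ) (T : Fin 3 → Fin 3 → ℂ → A) (lam2 : ℂ → ℂ) (u v : List ℂ) (Ωd : E) : E :=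
  ∑ S : Finset (Fin u.length), ∑ Q : Finset (Fin v.length),
    if S.card = Q.card then
      (prodGG c (sel v Q) (sel u S) * prodFF c (sel u S) (sel u Sᶜ) *
          prodGG c (sel v Qᶜ) (sel v Q) * prodHHne c (sel u S) * lamP lam2 (sel v Q)) •
        (op (TTrev c (T 2 1) (sel v Qᶜ) * Tprod (T 1 0) (sel u Sᶜ) *
              TTrev c (T 2 0) (sel u S)) • Ωd)
    else 0

/-- The dual `Y(2|1)` Bethe vector `Ψ_{a,b}(ū,v̄)`. -/
def Psi {E : Type*} [AddCommGroup E] [Module ℂ E] [Module Aᵐᵒᵖ E]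
    (c : ℂ) (T : Fin 3 → Fin 3 → ℂ → A) (lam2 : ℂ → ℂ) (u v : List ℂ) (Ωd : E) : E :=
  ((-1 : ℂ) ^ (v.length * (v.length - 1) / 2)) • PsiA c T lam2 u v Ωd

/-- Second explicit expression for the dual `Y(2|1)` Bethe vector, without the
overall sign `(-1)^{b(b-1)/2}`. -/
def PsiB {E : Type*} [AddCommGroup E] [Module ℂ E] [Module Aᵐᵒᵖ E]
    (c : ℂ) (T : Fin 3 → Fin 3 → ℂ → A) (lam2 : ℂ → ℂ) (u v : List ℂ) (Ωd : E) : E :=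
  ∑ S : Finset (Fin u.length), ∑ Q : Finset (Fin v.length),
    if S.card = Q.card then
      (KizL c (sel v Q) (sel u S) * prodFF c (sel u S) (sel u Sᶜ) *
          prodGG c (sel v Qᶜ) (sel v Q) * lamP lam2 (sel u S)) •
        (op (Tprod (T 1 0) (sel u Sᶜ) * TTrev c (T 2 1) (sel v Qᶜ) *
              TTrev c (T 2 0) (sel v Q)) • Ωd)
    else 0


/-! ### Scalar identities -/

lemma core1 (c : ℂ) (a : ℂ) (S R Q : Finset ℂ) (haR : a ∉ R) (haQ : a ∉ Q)
    (hRQ : Disjoint R Q) (hcard : Q.card = S.card + 1) :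
    ∑ x ∈ insert a (R ∪ Q), ((∏ y ∈ S, (x - y + c)) * ∏ y ∈ R, (x - y + c)) /
      ∏ y ∈ (insert a (R ∪ Q)).erase x, (x - y) = 0 := by
  set P : Polynomial ℂ := (∏ y ∈ S, (Polynomial.X - Polynomial.C (y - c))) *
    ∏ y ∈ R, (Polynomial.X - Polynomial.C (y - c)) with hP
  have hdeg : P.natDegree = S.card + R.card := by
    rw [hP, Polynomial.Monic.natDegree_mul]
    · rw [Polynomial.natDegree_finsetProd_X_sub_C_eq_card, Polynomial.natDegree_finsetProd_X_sub_C_eq_card]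
    · exact Polynomial.monic_prod_X_sub_C _ _
    · exact Polynomial.monic_prod_X_sub_C _ _
  have hN : (insert a (R ∪ Q)).card = S.card + R.card + 2 := by
    rw [Finset.card_insert_of_notMem (by simp [haR, haQ]), Finset.card_union_of_disjoint hRQ, hcard]
    ring
  have h1 : P.degree < ((insert a (R ∪ Q)).card : ℕ) := by
    refine lt_of_le_of_lt Polynomial.degree_le_natDegree ?_
    rw [hdeg, hN]; norm_cast; omega
  have h2 := Lagrange.coeff_eq_sum (s := insert a (R ∪ Q)) (v := id)
    (Set.injOn_id _) (P := P) h1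
  rw [Polynomial.coeff_eq_zero_of_natDegree_lt (by rw [hdeg, hN]; omega)] at h2
  rw [h2]
  refine Finset.sum_congr rfl fun x _ => ?_
  simp only [hP, Polynomial.eval_mul, Polynomial.eval_prod, Polynomial.eval_sub,
    Polynomial.eval_X, Polynomial.eval_C, id]
  congr 2 <;> exact Finset.prod_congr rfl fun y _ => by ring

lemma prod_gg_right (c x : ℂ) (Q : Finset ℂ) :
    ∏ q ∈ Q, gg c q x = (-c) ^ Q.card / ∏ q ∈ Q, (x - q) := by
  rw [← Finset.prod_const, ← Finset.prod_div_distrib]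
  refine Finset.prod_congr rfl fun q _ => ?_
  rw [gg, ← neg_sub x q, div_neg, neg_div]

lemma prod_ff_left (c x : ℂ) (R : Finset ℂ) :
    ∏ y ∈ R, ff c x y = (∏ y ∈ R, (x - y + c)) / ∏ y ∈ R, (x - y) := by
  rw [← Finset.prod_div_distrib]; rfl

lemma prod_hh_left (c x : ℂ) (R : Finset ℂ) :
    ∏ y ∈ R, hh c x y = (∏ y ∈ R, (x - y + c)) / c ^ R.card := by
  rw [← Finset.prod_const, ← Finset.prod_div_distrib]; rfl

lemma core2 (c : ℂ) (hc : c ≠ 0) (a : ℂ) (S R Q : Finset ℂ) (haR : a ∉ R) (haQ : a ∉ Q)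
    (hRQ : Disjoint R Q) (hcard : Q.card = S.card + 1) :
    (∏ q ∈ Q, gg c q a) * (∏ y ∈ R, ff c a y) * (∏ y ∈ S, hh c a y) +
      ∑ k ∈ R, (∏ q ∈ Q, gg c q k) * (∏ y ∈ R.erase k, ff c k y) * (∏ y ∈ S, hh c k y) * gg c k a
    = ∑ x ∈ Q, gg c x a * (∏ y ∈ S, hh c x y) * (∏ y ∈ R, ff c x y) *
        ∏ q ∈ Q.erase x, gg c q x := by
  have h := core1 c a S R Q haR haQ hRQ hcard
  rw [Finset.sum_insert (by simp [haR, haQ]), Finset.sum_union hRQ] at h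
  have h0 := congrArg (fun t => (-1) ^ (S.card + 1) * c * t) h
  simp only [mul_zero, mul_add, Finset.mul_sum] at h0
  rw [← sub_eq_zero, ← h0, ← add_assoc, sub_eq_add_neg, ← Finset.sum_neg_distrib]
  have hcn : c ^ S.card ≠ 0 := pow_ne_zero _ hc
  have hp : (-c) ^ (S.card + 1) = (-1) ^ (S.card + 1) * c * c ^ S.card := by
    rw [neg_pow]; ring
  have hp' : (-c) ^ (S.card) = (-1) ^ (S.card) * c ^ S.card := by
    rw [neg_pow]
  congr 1
  · congr 1
    · rw [prod_gg_right, prod_ff_left, prod_hh_left, Finset.erase_insert (by simp [haR, haQ]),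
        Finset.prod_union hRQ, hcard, hp]
      simp only [div_eq_mul_inv, mul_inv]
      field_simp
    · refine Finset.sum_congr rfl fun k hk => ?_
      have hkQ : k ∉ Q := Finset.disjoint_left.mp hRQ hk
      have hka : k ≠ a := fun h => haR (h ▸ hk)
      have e : (insert a (R ∪ Q)).erase k = insert a (R.erase k ∪ Q) := by
        ext t; simp only [Finset.mem_erase, Finset.mem_insert, Finset.mem_union]
        constructor
        · tauto
        · rintro (rfl | ⟨h1, h2⟩ | h1)
          · exact ⟨hka.symm, Or.inl rfl⟩
          · tauto
          · exact ⟨fun h => hkQ (h ▸ h1), by tauto⟩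
      have hd : Disjoint (R.erase k) Q := hRQ.mono_left (Finset.erase_subset _ _)
      rw [prod_gg_right, prod_ff_left, prod_hh_left, e,
        Finset.prod_insert (by simp [haR, haQ]), Finset.prod_union hd, hcard, hp,
        ← Finset.mul_prod_erase R _ hk, gg]
      simp only [div_eq_mul_inv, mul_inv, sub_self, zero_add]
      field_simp
  · refine Finset.sum_congr rfl fun k hk => ?_
    have hkR : k ∉ R := Finset.disjoint_right.mp hRQ hk
    have hka : k ≠ a := fun h => haQ (h ▸ hk)
    have e : (insert a (R ∪ Q)).erase k = insert a (R ∪ Q.erase k) := by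
        ext t; simp only [Finset.mem_erase, Finset.mem_insert, Finset.mem_union]
        constructor
        · tauto
        · rintro (rfl | h1 | ⟨h1, h2⟩)
          · exact ⟨hka.symm, Or.inl rfl⟩
          · exact ⟨fun h => hkR (h ▸ h1), by tauto⟩
          · tauto
    have hd : Disjoint R (Q.erase k) := hRQ.mono_right (Finset.erase_subset _ _)
    rw [prod_gg_right, prod_ff_left, prod_hh_left, e,
        Finset.prod_insert (by simp [haR, haQ]), Finset.prod_union hd,
        Finset.card_erase_of_mem hk, hcard, Nat.add_sub_cancel, hp', gg, pow_succ]
    simp only [div_eq_mul_inv, mul_inv]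
    field_simp

/-! ### Symmetry of normalized products -/

/-- `x - y + c ≠ 0` for distinct elements of a finite set. -/
def Adm (c : ℂ) (s : Finset ℂ) : Prop := ∀ x ∈ s, ∀ y ∈ s, x ≠ y → x - y + c ≠ 0

lemma Adm.mono {c : ℂ} {s t : Finset ℂ} (h : Adm c t) (hs : s ⊆ t) : Adm c s :=
  fun x hx y hy => h x (hs hx) y (hs hy)

lemma HnormRev_snoc (c : ℂ) (l : List ℂ) (x : ℂ) :
    HnormRev c (l ++ [x]) = HnormRev c l * (l.map fun y => hh c y x).prod := by
  induction l with
  | nil => simp [HnormRev]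
  | cons a l ih => simp [HnormRev, ih]; ring

lemma Tprod_perm {t : ℂ → A} {l l' : List ℂ} (h : l.Perm l')
    (ht : ∀ x ∈ l, ∀ y ∈ l, x ≠ y → t x * t y = t y * t x) : Tprod t l = Tprod t l' := by
  induction h with
  | nil => rfl
  | cons x h ih =>
    have := ih fun a ha b hb => ht a (by simp [ha]) b (by simp [hb])
    simp only [Tprod, List.map_cons, List.prod_cons] at this ⊢
    rw [this]
  | swap x y l =>
    by_cases hxy : y = x
    · subst hxy; rfl
    · have := ht y (by simp) x (by simp) hxy
      simp only [Tprod, List.map_cons, List.prod_cons]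
      rw [← mul_assoc, this, mul_assoc]
  | trans h1 h2 ih1 ih2 =>
    rw [ih1 ht, ih2 fun a ha b hb => ht a (h1.mem_iff.mpr ha) b (h1.mem_iff.mpr hb)]

lemma TTrev_cons (c : ℂ) (t : ℂ → A) (x : ℂ) (l : List ℂ) :
    TTrev c t (x :: l) = ((l.map fun y => hh c x y).prod)⁻¹ • (t x * TTrev c t l) := by
  simp only [TTrev, HnormRev, Tprod, List.map_cons, List.prod_cons, mul_inv, mul_smul_comm,
    smul_smul]

lemma TTrev_perm {c : ℂ} {t : ℂ → A} {l l' : List ℂ} (h : l.Perm l') (hn : l.Nodup)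
    (hne : ∀ x ∈ l, ∀ y ∈ l, x ≠ y → hh c x y ≠ 0)
    (ht : ∀ x ∈ l, ∀ y ∈ l, x ≠ y → hh c y x • (t x * t y) = hh c x y • (t y * t x)) :
    TTrev c t l = TTrev c t l' := by
  induction h with
  | nil => rfl
  | cons x h ih =>
    have := ih (List.nodup_cons.mp hn).2
      (fun a ha b hb => hne a (by simp [ha]) b (by simp [hb]))
      (fun a ha b hb => ht a (by simp [ha]) b (by simp [hb]))
    rw [TTrev_cons, TTrev_cons, this, (h.map _).prod_eq]
  | swap x y l =>
    have hxy : y ≠ x := by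
      intro h; simp [h] at hn
    have h1 := ht y (by simp) x (by simp) hxy
    have n1 := hne y (by simp) x (by simp) hxy
    have n2 := hne x (by simp) y (by simp) hxy.symm
    have h2 : t y * t x = ((hh c x y)⁻¹ * hh c y x) • (t x * t y) := by
      rw [mul_smul, ← h1, smul_smul, inv_mul_cancel₀ n2, one_smul]
    simp only [TTrev_cons, List.map_cons, List.prod_cons, mul_smul_comm, smul_smul, ← mul_assoc]
    rw [h2, smul_mul_assoc, smul_smul]
    congr 1
    simp only [mul_inv]
    field_simp
  | trans h1 h2 ih1 ih2 =>
    rw [ih1 hn hne ht, ih2 (h1.nodup_iff.mp hn)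
      (fun a ha b hb => hne a (h1.mem_iff.mpr ha) b (h1.mem_iff.mpr hb))
      (fun a ha b hb => ht a (h1.mem_iff.mpr ha) b (h1.mem_iff.mpr hb))]

lemma hh_ne {c : ℂ} (hc : c ≠ 0) {s : Finset ℂ} (h : Adm c s) {x y : ℂ} (hx : x ∈ s) (hy : y ∈ s)
    (hxy : x ≠ y) : hh c x y ≠ 0 := div_ne_zero (h x hx y hy hxy) hc

/-- normalized product over a finite set -/
def BF (c : ℂ) (t : ℂ → A) (s : Finset ℂ) : A := TTrev c t s.toList

/-- plain product over a finite set -/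
def DF (t : ℂ → A) (s : Finset ℂ) : A := Tprod t s.toList

lemma TTrev_eq_BF {c : ℂ} (hc : c ≠ 0) {t : ℂ → A}
    (ht : ∀ x y, x ≠ y → hh c y x • (t x * t y) = hh c x y • (t y * t x))
    {l : List ℂ} (hn : l.Nodup) (ha : Adm c l.toFinset) : TTrev c t l = BF c t l.toFinset := by
  refine TTrev_perm (List.toFinset_toList hn).symm hn ?_ fun x _ y _ => ht x y
  intro x hx y hy hxy
  exact hh_ne hc ha (by simpa using hx) (by simpa using hy) hxy

lemma BF_insert {c : ℂ} (hc : c ≠ 0) {t : ℂ → A}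
    (ht : ∀ x y, x ≠ y → hh c y x • (t x * t y) = hh c x y • (t y * t x))
    {s : Finset ℂ} {x : ℂ} (hx : x ∉ s) (ha : Adm c (insert x s)) :
    BF c t (insert x s) = (∏ y ∈ s, hh c y x)⁻¹ • (BF c t s * t x) := by
  have hn : (s.toList ++ [x]).Nodup := by
    rw [List.nodup_append]
    refine ⟨s.nodup_toList, by simp, ?_⟩
    intro a ha b hb; simp at ha hb; rintro rfl; exact hx (hb ▸ ha)
  have e : (s.toList ++ [x]).toFinset = insert x s := by
    ext y; simp
  have := TTrev_eq_BF hc ht hn (e ▸ ha)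
  rw [e] at this
  rw [← this, TTrev, HnormRev_snoc, BF, TTrev, Finset.prod_map_toList]
  simp only [Tprod, List.map_append, List.prod_append, List.map_cons, List.map_nil,
    List.prod_cons, List.prod_nil, mul_one, smul_mul_assoc, smul_smul, mul_inv]
  rw [mul_comm (∏ y ∈ s, hh c y x)⁻¹]

lemma Tprod_eq_DF {c : ℂ} {t : ℂ → A}
    (ht : ∀ x y, x ≠ y → y - x + c ≠ 0 → t x * t y = t y * t x)
    {l : List ℂ} (hn : l.Nodup) (ha : Adm c l.toFinset) : Tprod t l = DF t l.toFinset := by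
  refine Tprod_perm (List.toFinset_toList hn).symm ?_
  intro x hx y hy hxy
  exact ht x y hxy (ha y (by simpa using hy) x (by simpa using hx) hxy.symm)

lemma DF_insert {c : ℂ} {t : ℂ → A}
    (ht : ∀ x y, x ≠ y → y - x + c ≠ 0 → t x * t y = t y * t x)
    {s : Finset ℂ} {x : ℂ} (hx : x ∉ s) (ha : Adm c (insert x s)) :
    DF t (insert x s) = DF t s * t x := by
  have hn : (s.toList ++ [x]).Nodup := by
    rw [List.nodup_append]
    refine ⟨s.nodup_toList, by simp, ?_⟩
    intro a ha b hb; simp at ha hb; rintro rfl; exact hx (hb ▸ ha)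
  have e : (s.toList ++ [x]).toFinset = insert x s := by
    ext y; simp
  have := Tprod_eq_DF ht hn (e ▸ ha)
  rw [e] at this
  rw [← this, DF]
  simp only [Tprod, List.map_append, List.prod_append, List.map_cons, List.map_nil,
    List.prod_cons, List.prod_nil, mul_one]

/-! ### Commutation relations -/

lemma rel_odd {c : ℂ} (hc : c ≠ 0) {T : Fin 3 → Fin 3 → ℂ → A} (hT : IsTFam c p21 T) (j : Fin 3)
    (hj : j ≠ 2) (x y : ℂ) (hxy : x ≠ y) :
    hh c y x • (T 2 j x * T 2 j y) = hh c x y • (T 2 j y * T 2 j x) := by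
  have h := hT 2 j 2 j x y hxy
  have hp : p21 j = 0 := by fin_cases j <;> simp [p21] at hj ⊢
  have hp2 : p21 2 = 1 := rfl
  rw [hp, hp2] at h
  have hd : x - y ≠ 0 := sub_ne_zero.mpr hxy
  have h' := congrArg (fun t => ((y - x) / c) • t) h
  have e1 : hh c y x = 1 + (y - x) / c := by simp only [hh]; field_simp; ring
  have e2 : hh c x y = 1 - (y - x) / c := by simp only [hh]; field_simp; ring
  have e3 : (y - x) / c * gg c x y = -1 := by simp only [gg]; field_simp; ring
  simp only [smul_smul, smul_sub] at h'
  norm_num at h'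
  rw [e3] at h'
  rw [e1, e2, add_smul, sub_smul]
  simp only [neg_smul, one_smul] at h' ⊢
  rw [← sub_eq_zero] at h' ⊢
  rw [← h']
  abel

lemma rel_even {c : ℂ} {T : Fin 3 → Fin 3 → ℂ → A} (hT : IsTFam c p21 T)
    (x y : ℂ) (hxy : x ≠ y) (hne : y - x + c ≠ 0) :
    T 1 0 x * T 1 0 y = T 1 0 y * T 1 0 x := by
  have h := hT 1 0 1 0 x y hxy
  have hd : x - y ≠ 0 := sub_ne_zero.mpr hxy
  have hp : p21 0 = 0 := rfl
  have hp2 : p21 1 = 0 := rfl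
  rw [hp, hp2] at h
  norm_num at h
  rw [sub_eq_zero.symm]
  have h2 : (1 - gg c x y) • (T 1 0 x * T 1 0 y - T 1 0 y * T 1 0 x) = 0 := by
    rw [sub_smul, one_smul, sub_eq_zero]
    exact h
  refine (smul_eq_zero.mp h2).resolve_left ?_
  rw [gg, one_sub_div hd]
  refine div_ne_zero ?_ hd
  intro h; apply hne; linear_combination -h

lemma rel_mix {c : ℂ} {T : Fin 3 → Fin 3 → ℂ → A} (hT : IsTFam c p21 T)
    (w z : ℂ) (hwz : w ≠ z) :
    T 2 0 w * T 1 0 z = ff c w z • (T 1 0 z * T 2 0 w) - gg c w z • (T 1 0 w * T 2 0 z) := by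
  have h := hT 1 0 2 0 z w hwz.symm
  have hd : w - z ≠ 0 := sub_ne_zero.mpr hwz
  have hp : p21 0 = 0 := rfl
  have hp1 : p21 1 = 0 := rfl
  have hp2 : p21 2 = 1 := rfl
  rw [hp, hp1, hp2] at h
  norm_num at h
  have e1 : ff c w z = 1 + gg c w z := by simp only [ff, gg]; field_simp
  have e2 : gg c z w = - gg c w z := by
    rw [gg, gg, ← neg_sub w z, div_neg]
  rw [e2] at h
  rw [e1, add_smul, one_smul]
  rw [sub_eq_iff_eq_add] at h
  rw [smul_sub, neg_smul, neg_smul] at h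
  nth_rewrite 1 [h]
  abel

lemma ff_eq {c x y : ℂ} (hc : c ≠ 0) : ff c x y = hh c x y * gg c x y := by
  simp only [ff, hh, gg]; field_simp

/-- Moving `T₂₁(z)` through the normalized product of `T₃₁`. -/
lemma comm {c : ℂ} (hc : c ≠ 0) {T : Fin 3 → Fin 3 → ℂ → A} (hT : IsTFam c p21 T)
    (w : Finset ℂ) : ∀ z, z ∉ w → Adm c (insert z w) →
    (∏ x ∈ w, ff c x z) • (T 1 0 z * BF c (T 2 0) w) = BF c (T 2 0) w * T 1 0 z +
      ∑ k ∈ w, (gg c k z * ∏ y ∈ w.erase k, gg c y k) •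
        (T 1 0 k * (BF c (T 2 0) (w.erase k) * T 2 0 z)) := by
  have ht := rel_odd hc hT 0 (by decide)
  induction w using Finset.induction_on with
  | empty => intro z _ _; simp [BF, TTrev, HnormRev, Tprod]
  | insert x w hxw ih =>
    intro z hz hadm
    have hzw : z ∉ w := fun h => hz (Finset.mem_insert_of_mem h)
    have hzx : z ≠ x := fun h => hz (h ▸ Finset.mem_insert_self _ _)
    have hadx : Adm c (insert x w) := hadm.mono (Finset.subset_insert _ _)
    have hadz : Adm c (insert z w) :=
      hadm.mono (Finset.insert_subset_insert _ (Finset.subset_insert _ _))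
    have ihz := ih z hzw hadz
    have ihx := ih x hxw hadx
    have nxz : hh c x z ≠ 0 := hh_ne hc hadm (by simp) (by simp) hzx.symm
    have htt : T 2 0 z * T 2 0 x = (hh c z x * (hh c x z)⁻¹) • (T 2 0 x * T 2 0 z) := by
      rw [mul_comm, mul_smul, ← ht z x hzx, smul_smul, inv_mul_cancel₀ nxz, one_smul]
    have hB := BF_insert hc ht hxw hadx
    have hBz := rel_mix hT x z hzx.symm
    set H := ∏ y ∈ w, hh c y x with hH
    -- left-hand side
    have L1 : (∏ y ∈ insert x w, ff c y z) • (T 1 0 z * BF c (T 2 0) (insert x w)) =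
        (H⁻¹ * ff c x z) • (BF c (T 2 0) w * (T 1 0 z * T 2 0 x)) +
        ∑ k ∈ w, (H⁻¹ * ff c x z * (gg c k z * ∏ y ∈ w.erase k, gg c y k) *
          (hh c z x * (hh c x z)⁻¹)) •
          (T 1 0 k * (BF c (T 2 0) (w.erase k) * (T 2 0 x * T 2 0 z))) := by
      rw [Finset.prod_insert hxw, hB]
      have e : (ff c x z * ∏ y ∈ w, ff c y z) • (T 1 0 z * H⁻¹ • (BF c (T 2 0) w * T 2 0 x)) =
          (H⁻¹ * ff c x z) • (((∏ y ∈ w, ff c y z) • (T 1 0 z * BF c (T 2 0) w)) * T 2 0 x) := by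
        simp only [mul_smul_comm, smul_mul_assoc, smul_smul, mul_assoc]
        congr 1; ring
      rw [e, ihz, add_mul, smul_add, mul_assoc, Finset.sum_mul, Finset.smul_sum]
      congr 1
      refine Finset.sum_congr rfl fun k _ => ?_
      rw [smul_mul_assoc, mul_assoc, mul_assoc, htt]
      simp only [mul_smul_comm, smul_smul, mul_assoc]
    have R1 : BF c (T 2 0) (insert x w) * T 1 0 z =
        (H⁻¹ * ff c x z) • (BF c (T 2 0) w * (T 1 0 z * T 2 0 x)) -
        (H⁻¹ * gg c x z * ∏ y ∈ w, ff c y x) • (T 1 0 x * (BF c (T 2 0) w * T 2 0 z)) +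
        ∑ k ∈ w, (H⁻¹ * gg c x z * (gg c k x * ∏ y ∈ w.erase k, gg c y k)) •
          (T 1 0 k * (BF c (T 2 0) (w.erase k) * (T 2 0 x * T 2 0 z))) := by
      rw [hB, smul_mul_assoc, mul_assoc, hBz, mul_sub, mul_smul_comm, mul_smul_comm]
      have e : BF c (T 2 0) w * (T 1 0 x * T 2 0 z) =
          ((∏ y ∈ w, ff c y x) • (T 1 0 x * BF c (T 2 0) w)) * T 2 0 z -
          (∑ k ∈ w, (gg c k x * ∏ y ∈ w.erase k, gg c y k) •
            (T 1 0 k * (BF c (T 2 0) (w.erase k) * T 2 0 x))) * T 2 0 z := by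
        rw [ihx, add_mul, ← mul_assoc]; abel
      rw [e]
      simp only [smul_sub, smul_smul, smul_mul_assoc, mul_assoc, Finset.sum_mul, Finset.smul_sum]
      abel
    have R2 : ∑ k ∈ insert x w, (gg c k z * ∏ y ∈ (insert x w).erase k, gg c y k) •
        (T 1 0 k * (BF c (T 2 0) ((insert x w).erase k) * T 2 0 z)) =
        (gg c x z * ∏ y ∈ w, gg c y x) • (T 1 0 x * (BF c (T 2 0) w * T 2 0 z)) +
        ∑ k ∈ w, (gg c k z * (gg c x k * ∏ y ∈ w.erase k, gg c y k) *
            (∏ y ∈ w.erase k, hh c y x)⁻¹) •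
          (T 1 0 k * (BF c (T 2 0) (w.erase k) * (T 2 0 x * T 2 0 z))) := by
      rw [Finset.sum_insert hxw, Finset.erase_insert hxw]
      congr 1
      refine Finset.sum_congr rfl fun k hk => ?_
      have hkx : x ≠ k := fun h => hxw (h ▸ hk)
      have hxk : x ∉ w.erase k := fun h => hxw (Finset.mem_of_mem_erase h)
      rw [Finset.erase_insert_of_ne hkx, Finset.prod_insert hxk, BF_insert hc ht hxk
        (hadx.mono (Finset.insert_subset_insert _ (Finset.erase_subset _ _)))]
      simp only [mul_smul_comm, smul_mul_assoc, smul_smul, mul_assoc]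
    have hH0 : H ≠ 0 := Finset.prod_ne_zero_iff.mpr fun y hy =>
      hh_ne hc hadx (by simp [hy]) (by simp) (fun h => hxw (h ▸ hy))
    have eF : H⁻¹ * gg c x z * ∏ y ∈ w, ff c y x = gg c x z * ∏ y ∈ w, gg c y x := by
      have : ∏ y ∈ w, ff c y x = H * ∏ y ∈ w, gg c y x := by
        rw [hH, ← Finset.prod_mul_distrib]
        exact Finset.prod_congr rfl fun y _ => ff_eq hc
      rw [this]; field_simp
    have key : ∑ k ∈ w, (H⁻¹ * ff c x z * (gg c k z * ∏ y ∈ w.erase k, gg c y k) *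
          (hh c z x * (hh c x z)⁻¹)) •
          (T 1 0 k * (BF c (T 2 0) (w.erase k) * (T 2 0 x * T 2 0 z))) =
        ∑ k ∈ w, (H⁻¹ * gg c x z * (gg c k x * ∏ y ∈ w.erase k, gg c y k)) •
          (T 1 0 k * (BF c (T 2 0) (w.erase k) * (T 2 0 x * T 2 0 z))) +
        ∑ k ∈ w, (gg c k z * (gg c x k * ∏ y ∈ w.erase k, gg c y k) *
            (∏ y ∈ w.erase k, hh c y x)⁻¹) •
          (T 1 0 k * (BF c (T 2 0) (w.erase k) * (T 2 0 x * T 2 0 z))) := by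
      rw [← Finset.sum_add_distrib]
      refine Finset.sum_congr rfl fun k hk => ?_
      rw [← add_smul]
      congr 1
      have hkx : k ≠ x := fun h => hxw (h ▸ hk)
      have hkz : k ≠ z := fun h => hzw (h ▸ hk)
      have nkx : hh c k x ≠ 0 := hh_ne hc hadx (by simp [hk]) (by simp) hkx
      have hHk : H = hh c k x * ∏ y ∈ w.erase k, hh c y x := (Finset.mul_prod_erase w (fun y => hh c y x) hk).symm
      have hHk0 : ∏ y ∈ w.erase k, hh c y x ≠ 0 := by
        intro h; rw [h, mul_zero] at hHk; exact hH0 hHk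
      rw [hHk]
      generalize ∏ y ∈ w.erase k, hh c y x = P at *
      generalize ∏ y ∈ w.erase k, gg c y k = G at *
      have id1 : gg c x z * gg c k z * hh c z x =
          gg c x z * gg c k x + gg c k z * gg c x k * hh c k x := by
        have d1 : x - z ≠ 0 := sub_ne_zero.mpr hzx.symm
        have d2 : k - z ≠ 0 := sub_ne_zero.mpr hkz
        have d3 : k - x ≠ 0 := sub_ne_zero.mpr hkx
        have d4 : x - k ≠ 0 := sub_ne_zero.mpr hkx.symm
        simp only [gg, hh]
        rw [show c / (x - k) = - (c / (k - x)) by rw [← neg_sub k x, div_neg]]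
        field_simp
        ring
      rw [ff_eq hc]
      field_simp
      linear_combination G * id1
    rw [L1, R1, R2, eF, key]
    abel

/-! ### Finite set version -/

/-- double product over finite sets -/
def PP (F : ℂ → ℂ → ℂ) (X Y : Finset ℂ) : ℂ := ∏ x ∈ X, ∏ y ∈ Y, F x y

/-- product over ordered pairs of distinct elements -/
def hN (c : ℂ) (S : Finset ℂ) : ℂ := ∏ x ∈ S, ∏ y ∈ S.erase x, hh c x y

lemma PP_insert_left {F : ℂ → ℂ → ℂ} {X Y : Finset ℂ} {a : ℂ} (ha : a ∉ X) :
    PP F (insert a X) Y = (∏ y ∈ Y, F a y) * PP F X Y := by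
  rw [PP, Finset.prod_insert ha, PP]

lemma PP_insert_right {F : ℂ → ℂ → ℂ} {X Y : Finset ℂ} {a : ℂ} (ha : a ∉ Y) :
    PP F X (insert a Y) = (∏ x ∈ X, F x a) * PP F X Y := by
  simp only [PP, Finset.prod_insert ha, Finset.prod_mul_distrib]

lemma PP_erase_left {F : ℂ → ℂ → ℂ} {X Y : Finset ℂ} {a : ℂ} (ha : a ∈ X) :
    PP F X Y = (∏ y ∈ Y, F a y) * PP F (X.erase a) Y := by
  rw [← PP_insert_left (Finset.notMem_erase a X), Finset.insert_erase ha]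

lemma PP_erase_right {F : ℂ → ℂ → ℂ} {X Y : Finset ℂ} {a : ℂ} (ha : a ∈ Y) :
    PP F X Y = (∏ x ∈ X, F x a) * PP F X (Y.erase a) := by
  rw [← PP_insert_right (Finset.notMem_erase a Y), Finset.insert_erase ha]

lemma hN_insert {c : ℂ} {S : Finset ℂ} {a : ℂ} (ha : a ∉ S) :
    hN c (insert a S) = (∏ y ∈ S, hh c a y) * (∏ y ∈ S, hh c y a) * hN c S := by
  rw [hN, Finset.prod_insert ha, Finset.erase_insert ha, hN, mul_assoc]
  congr 1
  rw [← Finset.prod_mul_distrib]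
  refine Finset.prod_congr rfl fun x hx => ?_
  have hax : a ≠ x := fun h => ha (h ▸ hx)
  have hax' : a ∉ S.erase x := fun h => ha (Finset.mem_of_mem_erase h)
  rw [Finset.erase_insert_of_ne hax, Finset.prod_insert hax']

/-- coefficient in the explicit formula -/
def WW (c : ℂ) (lam : ℂ → ℂ) (U V S Q : Finset ℂ) : ℂ :=
  PP (gg c) Q S * PP (ff c) S (U \ S) * PP (gg c) (V \ Q) Q * hN c S * ∏ q ∈ Q, lam q

/-- operator part of the dual Bethe vector, indexed by finite sets -/
def PsiOp (c : ℂ) (T : Fin 3 → Fin 3 → ℂ → A) (lam : ℂ → ℂ) (U V : Finset ℂ) : A :=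
  ∑ S ∈ U.powerset, ∑ Q ∈ V.powerset, if S.card = Q.card then
    WW c lam U V S Q • (BF c (T 2 1) (V \ Q) * DF (T 1 0) (U \ S) * BF c (T 2 0) S) else 0

lemma scalar_id {c : ℂ} (hc : c ≠ 0) (lam : ℂ → ℂ) {a : ℂ} {U V S Q : Finset ℂ} (haU : a ∉ U)
    (haV : a ∉ V) (hUV : Disjoint U V) (hadm : Adm c (insert a U)) (hS : S ⊆ U) (hQ : Q ⊆ V)
    (hcard : Q.card = S.card + 1) :
    WW c lam (insert a U) V (insert a S) Q * (∏ y ∈ S, hh c y a)⁻¹ +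
      ∑ k ∈ U \ S, WW c lam U V (insert k S) Q * (gg c k a * ∏ y ∈ S, gg c y k) =
    ∑ x ∈ Q, (lam x * gg c x a * (∏ y ∈ U, ff c x y) * ∏ q ∈ V.erase x, gg c q x) *
      WW c lam U (V.erase x) S (Q.erase x) := by
  have haS : a ∉ S := fun h => haU (hS h)
  have hcore := core2 c hc a S (U \ S) Q (fun h => haU (Finset.mem_sdiff.mp h).1)
    (fun h => haV (hQ h)) (hUV.mono Finset.sdiff_subset hQ) hcard
  have hcore' := congrArg (fun t => WW c lam U V S Q * t) hcore
  simp only [mul_add, Finset.mul_sum] at hcore'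
  refine Eq.trans ?_ (hcore'.trans ?_)
  · congr 1
    · have e : insert a U \ insert a S = U \ S := by
        ext t; simp only [Finset.mem_sdiff, Finset.mem_insert]
        constructor
        · tauto
        · rintro ⟨h1, h2⟩
          exact ⟨Or.inr h1, fun h => h.elim (fun h => haU (h ▸ h1)) h2⟩
      have h0 : ∏ y ∈ S, hh c y a ≠ 0 := Finset.prod_ne_zero_iff.mpr fun y hy =>
        hh_ne hc hadm (by simp [hS hy]) (by simp) (fun h => haS (h ▸ hy))
      rw [WW, e, PP_insert_right haS, PP_insert_left haS, hN_insert haS, WW]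
      field_simp
    · refine Finset.sum_congr rfl fun k hk => ?_
      have hkS : k ∉ S := (Finset.mem_sdiff.mp hk).2
      have e : U \ insert k S = (U \ S).erase k := by
        ext t; simp only [Finset.mem_sdiff, Finset.mem_insert, Finset.mem_erase]; tauto
      have ef : ∏ y ∈ S, ff c y k = (∏ y ∈ S, hh c y k) * ∏ y ∈ S, gg c y k := by
        rw [← Finset.prod_mul_distrib]; exact Finset.prod_congr rfl fun y _ => ff_eq hc
      rw [WW, e, PP_insert_right hkS, PP_insert_left hkS, hN_insert hkS, WW,
        PP_erase_right (F := ff c) hk, ef]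
      ring
  · refine Finset.sum_congr rfl fun x hx => ?_
    have e : V.erase x \ Q.erase x = V \ Q := by
      ext t; simp only [Finset.mem_sdiff, Finset.mem_erase]
      constructor
      · tauto
      · rintro ⟨h1, h2⟩
        exact ⟨⟨fun h => h2 (h ▸ hx), h1⟩, fun h => h2 h.2⟩
    have ef : ∏ y ∈ S, ff c x y = (∏ y ∈ S, hh c x y) * ∏ y ∈ S, gg c x y := by
      rw [← Finset.prod_mul_distrib]; exact Finset.prod_congr rfl fun y _ => ff_eq hc
    have eU : ∏ y ∈ U, ff c x y = (∏ y ∈ U \ S, ff c x y) * ∏ y ∈ S, ff c x y :=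
      (Finset.prod_sdiff (f := fun y => ff c x y) hS).symm
    have eV : ∏ q ∈ V.erase x, gg c q x =
        (∏ q ∈ V \ Q, gg c q x) * ∏ q ∈ Q.erase x, gg c q x := by
      rw [← e]
      exact (Finset.prod_sdiff (Finset.erase_subset_erase _ hQ)).symm
    rw [WW, WW, e, eU, eV, ef, PP_erase_left (X := Q) hx, PP_erase_right (Y := Q) hx,
      ← Finset.mul_prod_erase Q lam hx]
    ring

lemma reindex1 {M : Type*} [AddCommMonoid M] (U : Finset ℂ) (F : Finset ℂ → ℂ → M) :
    ∑ S ∈ U.powerset, ∑ k ∈ S, F S k = ∑ S ∈ U.powerset, ∑ k ∈ U \ S, F (insert k S) k := by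
  rw [Finset.sum_sigma', Finset.sum_sigma']
  refine Finset.sum_bij' (fun p _ => ⟨p.1.erase p.2, p.2⟩) (fun p _ => ⟨insert p.2 p.1, p.2⟩)
    ?_ ?_ ?_ ?_ ?_
  · rintro ⟨S, k⟩ h
    simp only [Finset.mem_sigma, Finset.mem_powerset, Finset.mem_sdiff] at h ⊢
    exact ⟨(Finset.erase_subset _ _).trans h.1, h.1 h.2, Finset.notMem_erase _ _⟩
  · rintro ⟨S, k⟩ h
    simp only [Finset.mem_sigma, Finset.mem_powerset, Finset.mem_sdiff] at h ⊢
    exact ⟨Finset.insert_subset h.2.1 h.1, Finset.mem_insert_self _ _⟩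
  · rintro ⟨S, k⟩ h
    simp only [Finset.mem_sigma] at h
    simp [Finset.insert_erase h.2]
  · rintro ⟨S, k⟩ h
    simp only [Finset.mem_sigma, Finset.mem_sdiff] at h
    simp [Finset.erase_insert h.2.2]
  · rintro ⟨S, k⟩ h
    simp only [Finset.mem_sigma] at h
    simp [Finset.insert_erase h.2]

lemma reindex2 {M : Type*} [AddCommMonoid M] (V : Finset ℂ) (G : ℂ → Finset ℂ → M) :
    ∑ x ∈ V, ∑ Q ∈ (V.erase x).powerset, G x Q = ∑ Q ∈ V.powerset, ∑ x ∈ Q, G x (Q.erase x) := by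
  rw [Finset.sum_sigma', Finset.sum_sigma']
  refine Finset.sum_bij' (fun p _ => ⟨insert p.1 p.2, p.1⟩) (fun p _ => ⟨p.2, p.1.erase p.2⟩)
    ?_ ?_ ?_ ?_ ?_
  · rintro ⟨x, Q⟩ h
    simp only [Finset.mem_sigma, Finset.mem_powerset] at h ⊢
    exact ⟨Finset.insert_subset h.1 (h.2.trans (Finset.erase_subset _ _)),
      Finset.mem_insert_self _ _⟩
  · rintro ⟨Q, x⟩ h
    simp only [Finset.mem_sigma, Finset.mem_powerset] at h ⊢
    exact ⟨h.1 h.2, Finset.erase_subset_erase _ h.1⟩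
  · rintro ⟨x, Q⟩ h
    simp only [Finset.mem_sigma, Finset.mem_powerset] at h
    have : x ∉ Q := fun hx => Finset.notMem_erase x V (h.2 hx)
    simp [Finset.erase_insert this]
  · rintro ⟨Q, x⟩ h
    simp only [Finset.mem_sigma] at h
    simp [Finset.insert_erase h.2]
  · rintro ⟨x, Q⟩ h
    simp only [Finset.mem_sigma, Finset.mem_powerset] at h
    have : x ∉ Q := fun hx => Finset.notMem_erase x V (h.2 hx)
    simp [Finset.erase_insert this]

lemma main_op {c : ℂ} (hc : c ≠ 0) {T : Fin 3 → Fin 3 → ℂ → A} (hT : IsTFam c p21 T)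
    (lam : ℂ → ℂ) {a : ℂ} {U V : Finset ℂ} (haU : a ∉ U)
    (haV : a ∉ V) (hUV : Disjoint U V) (hadm : Adm c (insert a U)) :
    PsiOp c T lam (insert a U) V = PsiOp c T lam U V * T 1 0 a +
      ∑ x ∈ V, (lam x * gg c x a * (∏ y ∈ U, ff c x y) * ∏ q ∈ V.erase x, gg c q x) •
        (PsiOp c T lam U (V.erase x) * T 2 0 a) := by
  have ht := rel_odd hc hT 0 (by decide)
  have hd := rel_even hT
  set X : Finset ℂ → Finset ℂ → A := fun S Q =>
    BF c (T 2 1) (V \ Q) * DF (T 1 0) (U \ S) * (BF c (T 2 0) S * T 2 0 a) with hX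
  -- terms without `a` in the first set
  have stepA : ∀ S ∈ U.powerset, ∀ Q ∈ V.powerset,
      WW c lam (insert a U) V S Q •
        (BF c (T 2 1) (V \ Q) * DF (T 1 0) (insert a U \ S) * BF c (T 2 0) S) =
      WW c lam U V S Q • (BF c (T 2 1) (V \ Q) * DF (T 1 0) (U \ S) * BF c (T 2 0) S) * T 1 0 a +
      ∑ k ∈ S, (WW c lam U V S Q * (gg c k a * ∏ y ∈ S.erase k, gg c y k)) • X (S.erase k) Q := by
    intro S hS Q hQ
    rw [Finset.mem_powerset] at hS hQ
    have haS : a ∉ S := fun h => haU (hS h)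
    have haR : a ∉ U \ S := fun h => haU (Finset.mem_sdiff.mp h).1
    have e : insert a U \ S = insert a (U \ S) := Finset.insert_sdiff_of_notMem _ haS
    have hW : WW c lam (insert a U) V S Q = WW c lam U V S Q * ∏ x ∈ S, ff c x a := by
      rw [WW, WW, e, PP_insert_right haR]; ring
    rw [hW, e, DF_insert hd haR
      (hadm.mono (Finset.insert_subset_insert _ Finset.sdiff_subset)), mul_smul]
    have e2 : (∏ x ∈ S, ff c x a) • (BF c (T 2 1) (V \ Q) * (DF (T 1 0) (U \ S) * T 1 0 a) *
        BF c (T 2 0) S) = BF c (T 2 1) (V \ Q) * DF (T 1 0) (U \ S) *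
        ((∏ x ∈ S, ff c x a) • (T 1 0 a * BF c (T 2 0) S)) := by
      simp only [mul_smul_comm, mul_assoc]
    rw [e2, comm hc hT S a haS (hadm.mono (Finset.insert_subset_insert _ hS)), mul_add, smul_add,
      smul_mul_assoc]
    congr 1
    · simp only [mul_assoc]
    · rw [Finset.mul_sum, Finset.smul_sum]
      refine Finset.sum_congr rfl fun k hk => ?_
      have hkR : k ∉ U \ S := fun h => (Finset.mem_sdiff.mp h).2 hk
      have e3 : U \ S.erase k = insert k (U \ S) := by
        ext t; simp only [Finset.mem_sdiff, Finset.mem_insert, Finset.mem_erase]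
        constructor
        · rintro ⟨h1, h2⟩
          by_cases h : t = k
          · exact Or.inl h
          · exact Or.inr ⟨h1, fun h3 => h2 ⟨h, h3⟩⟩
        · rintro (rfl | ⟨h1, h2⟩)
          · exact ⟨hS hk, fun h => h.1 rfl⟩
          · exact ⟨h1, fun h => h2 h.2⟩
      rw [mul_smul_comm, smul_smul]
      congr 1
      simp only [hX]
      rw [e3, DF_insert hd hkR (hadm.mono ((Finset.insert_subset (hS hk)
        Finset.sdiff_subset).trans (Finset.subset_insert _ _)))]
      simp only [mul_assoc]
  have stepB : ∀ S ∈ U.powerset, ∀ Q ∈ V.powerset,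
      WW c lam (insert a U) V (insert a S) Q •
        (BF c (T 2 1) (V \ Q) * DF (T 1 0) (insert a U \ insert a S) * BF c (T 2 0) (insert a S)) =
      (WW c lam (insert a U) V (insert a S) Q * (∏ y ∈ S, hh c y a)⁻¹) • X S Q := by
    intro S hS Q hQ
    rw [Finset.mem_powerset] at hS hQ
    have haS : a ∉ S := fun h => haU (hS h)
    have e : insert a U \ insert a S = U \ S := by
      ext t; simp only [Finset.mem_sdiff, Finset.mem_insert]
      constructor
      · tauto
      · rintro ⟨h1, h2⟩
        exact ⟨Or.inr h1, fun h => h.elim (fun h => haU (h ▸ h1)) h2⟩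
    rw [e, BF_insert hc ht haS (hadm.mono (Finset.insert_subset_insert _ hS)), mul_smul_comm,
      smul_smul]
  -- the left-hand side
  have hL : PsiOp c T lam (insert a U) V = PsiOp c T lam U V * T 1 0 a +
      ∑ S ∈ U.powerset, ∑ Q ∈ V.powerset, if S.card + 1 = Q.card then
        (WW c lam (insert a U) V (insert a S) Q * (∏ y ∈ S, hh c y a)⁻¹ +
          ∑ k ∈ U \ S, WW c lam U V (insert k S) Q * (gg c k a * ∏ y ∈ S, gg c y k)) • X S Q
        else 0 := by
    have h1 : PsiOp c T lam (insert a U) V = (PsiOp c T lam U V * T 1 0 a +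
        ∑ S ∈ U.powerset, ∑ Q ∈ V.powerset, ∑ k ∈ S, if S.card = Q.card then
          (WW c lam U V S Q * (gg c k a * ∏ y ∈ S.erase k, gg c y k)) • X (S.erase k) Q else 0) +
        ∑ S ∈ U.powerset, ∑ Q ∈ V.powerset, if S.card + 1 = Q.card then
          (WW c lam (insert a U) V (insert a S) Q * (∏ y ∈ S, hh c y a)⁻¹) • X S Q else 0 := by
      rw [PsiOp, Finset.sum_powerset_insert haU]
      congr 1
      · rw [PsiOp, Finset.sum_mul, ← Finset.sum_add_distrib]
        refine Finset.sum_congr rfl fun S hS => ?_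
        rw [Finset.sum_mul, ← Finset.sum_add_distrib]
        refine Finset.sum_congr rfl fun Q hQ => ?_
        split_ifs with h
        · exact stepA S hS Q hQ
        · simp
      · refine Finset.sum_congr rfl fun S hS => Finset.sum_congr rfl fun Q hQ => ?_
        rw [Finset.card_insert_of_notMem fun h => haU (Finset.mem_powerset.mp hS h)]
        split_ifs with h
        · exact stepB S hS Q hQ
        · rfl
    rw [h1, add_assoc]
    congr 1
    have h2 : ∑ S ∈ U.powerset, ∑ Q ∈ V.powerset, ∑ k ∈ S, (if S.card = Q.card then
          (WW c lam U V S Q * (gg c k a * ∏ y ∈ S.erase k, gg c y k)) • X (S.erase k) Q else 0) =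
        ∑ S ∈ U.powerset, ∑ Q ∈ V.powerset, ∑ k ∈ U \ S, (if S.card + 1 = Q.card then
          (WW c lam U V (insert k S) Q * (gg c k a * ∏ y ∈ S, gg c y k)) • X S Q else 0) := by
      rw [Finset.sum_comm, Finset.sum_comm (s := U.powerset)]
      refine Finset.sum_congr rfl fun Q _ => ?_
      rw [reindex1]
      refine Finset.sum_congr rfl fun S _ => Finset.sum_congr rfl fun k hk => ?_
      have hkS := (Finset.mem_sdiff.mp hk).2
      rw [Finset.erase_insert hkS, Finset.card_insert_of_notMem hkS]
    rw [h2, ← Finset.sum_add_distrib]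
    refine Finset.sum_congr rfl fun S _ => ?_
    rw [← Finset.sum_add_distrib]
    refine Finset.sum_congr rfl fun Q _ => ?_
    split_ifs with h
    · rw [add_smul, Finset.sum_smul, add_comm]
    · simp
  rw [hL]
  congr 1
  have hR : ∀ x ∈ V, (lam x * gg c x a * (∏ y ∈ U, ff c x y) * ∏ q ∈ V.erase x, gg c q x) •
        (PsiOp c T lam U (V.erase x) * T 2 0 a) =
      ∑ Q ∈ (V.erase x).powerset, ∑ S ∈ U.powerset, if S.card = Q.card then
        ((lam x * gg c x a * (∏ y ∈ U, ff c x y) * ∏ q ∈ V.erase x, gg c q x) *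
          WW c lam U (V.erase x) S Q) • (BF c (T 2 1) (V.erase x \ Q) * DF (T 1 0) (U \ S) *
          (BF c (T 2 0) S * T 2 0 a)) else 0 := by
    intro x _
    rw [PsiOp, Finset.sum_comm, Finset.sum_mul, Finset.smul_sum]
    refine Finset.sum_congr rfl fun Q _ => ?_
    rw [Finset.sum_mul, Finset.smul_sum]
    refine Finset.sum_congr rfl fun S _ => ?_
    split_ifs with h
    · rw [smul_mul_assoc, smul_smul, mul_assoc _ _ (T 2 0 a)]
    · simp
  rw [Finset.sum_congr rfl hR, reindex2, Finset.sum_comm]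
  refine Finset.sum_congr rfl fun Q hQ => ?_
  rw [Finset.sum_comm]
  refine Finset.sum_congr rfl fun S hS => ?_
  rw [Finset.mem_powerset] at hS hQ
  split_ifs with h
  · rw [scalar_id hc lam haU haV hUV hadm hS hQ h.symm, Finset.sum_smul]
    refine Finset.sum_congr rfl fun x hx => ?_
    rw [if_pos (by rw [Finset.card_erase_of_mem hx]; omega)]
    have e : V.erase x \ Q.erase x = V \ Q := by
      ext t; simp only [Finset.mem_sdiff, Finset.mem_erase]
      constructor
      · tauto
      · rintro ⟨h1, h2⟩
        exact ⟨⟨fun h => h2 (h ▸ hx), h1⟩, fun h => h2 h.2⟩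
    rw [e]
  · symm
    refine Finset.sum_eq_zero fun x hx => ?_
    rw [if_neg]
    rw [Finset.card_erase_of_mem hx]
    have := Finset.card_pos.mpr ⟨x, hx⟩
    omega

/-! ### From lists to finite sets -/

lemma toFinset_eq_image (l : List ℂ) : l.toFinset = Finset.univ.image l.get := by
  ext x
  simp only [List.mem_toFinset, Finset.mem_image, Finset.mem_univ, true_and]
  exact List.mem_iff_get

lemma get_inj {l : List ℂ} (hl : l.Nodup) : Function.Injective l.get :=
  List.nodup_iff_injective_get.mp hl

lemma sel_nodup {l : List ℂ} (hl : l.Nodup) (S : Finset (Fin l.length)) : (sel l S).Nodup :=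
  List.Nodup.map (get_inj hl) (Finset.sort_nodup _ _)

lemma sel_toFinset (l : List ℂ) (S : Finset (Fin l.length)) :
    (sel l S).toFinset = S.image l.get := by
  ext x; simp [sel]

lemma sel_toFinset_subset (l : List ℂ) (S : Finset (Fin l.length)) :
    (sel l S).toFinset ⊆ l.toFinset := by
  rw [sel_toFinset, toFinset_eq_image]
  exact Finset.image_subset_image (Finset.subset_univ _)

lemma image_compl {l : List ℂ} (hl : l.Nodup) (S : Finset (Fin l.length)) :
    Sᶜ.image l.get = l.toFinset \ S.image l.get := by
  rw [Finset.compl_eq_univ_sdiff, Finset.image_sdiff _ _ (get_inj hl), toFinset_eq_image]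

lemma sum_sel {M : Type*} [AddCommMonoid M] {l : List ℂ} (hl : l.Nodup) (F : Finset ℂ → M) :
    ∑ S : Finset (Fin l.length), F (S.image l.get) = ∑ S ∈ l.toFinset.powerset, F S := by
  rw [toFinset_eq_image, Finset.powerset_image, Finset.sum_image, Finset.powerset_univ]
  intro a _ b _ h
  exact Finset.image_injective (get_inj hl) h

lemma prodGG_eq {c : ℂ} {l l' : List ℂ} (h : l.Nodup) (h' : l'.Nodup) :
    prodGG c l l' = PP (gg c) l.toFinset l'.toFinset := by
  simp only [prodGG, PP, List.prod_toFinset _ h, List.prod_toFinset _ h']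

lemma prodFF_eq {c : ℂ} {l l' : List ℂ} (h : l.Nodup) (h' : l'.Nodup) :
    prodFF c l l' = PP (ff c) l.toFinset l'.toFinset := by
  simp only [prodFF, PP, List.prod_toFinset _ h, List.prod_toFinset _ h']

lemma prodHHne_eq {c : ℂ} {l : List ℂ} (h : l.Nodup) : prodHHne c l = hN c l.toFinset := by
  rw [prodHHne, hN, toFinset_eq_image, Finset.prod_image fun a _ b _ hab => get_inj h hab]
  refine Finset.prod_congr rfl fun j _ => ?_
  rw [← Finset.image_erase (get_inj h), Finset.prod_image fun a _ b _ hab => get_inj h hab,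
    ← Finset.prod_filter]
  refine Finset.prod_congr ?_ fun _ _ => rfl
  ext k; simp [eq_comm]

lemma PsiA_eq {E : Type*} [AddCommGroup E] [Module ℂ E] [Module Aᵐᵒᵖ E] [IsScalarTower ℂ Aᵐᵒᵖ E]
    {c : ℂ} (hc : c ≠ 0) {T : Fin 3 → Fin 3 → ℂ → A} (hT : IsTFam c p21 T) (lam : ℂ → ℂ) (Ωd : E)
    {u v : List ℂ} (hu : u.Nodup) (hv : v.Nodup) (au : Adm c u.toFinset) (av : Adm c v.toFinset) :
    PsiA c T lam u v Ωd = op (PsiOp c T lam u.toFinset v.toFinset) • Ωd := by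
  rw [PsiOp, Finset.op_sum, Finset.sum_smul, ← sum_sel hu, PsiA]
  refine Finset.sum_congr rfl fun S _ => ?_
  rw [Finset.op_sum, Finset.sum_smul, ← sum_sel hv]
  refine Finset.sum_congr rfl fun Q _ => ?_
  rw [Finset.card_image_of_injective _ (get_inj hu), Finset.card_image_of_injective _ (get_inj hv)]
  split_ifs with h
  · have nS := sel_nodup hu S
    have nSc := sel_nodup hu Sᶜ
    have nQ := sel_nodup hv Q
    have nQc := sel_nodup hv Qᶜ
    rw [prodGG_eq nQ nS, prodFF_eq nS nSc, prodGG_eq nQc nQ, prodHHne_eq nS, lamP,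
      ← List.prod_toFinset _ nQ,
      TTrev_eq_BF hc (rel_odd hc hT 1 (by decide)) nQc (av.mono (sel_toFinset_subset _ _)),
      TTrev_eq_BF hc (rel_odd hc hT 0 (by decide)) nS (au.mono (sel_toFinset_subset _ _)),
      Tprod_eq_DF (rel_even hT) nSc (au.mono (sel_toFinset_subset _ _))]
    simp only [sel_toFinset, image_compl hu, image_compl hv]
    rw [← smul_assoc, ← op_smul, WW]
  · simp

lemma Psi_eq {E : Type*} [AddCommGroup E] [Module ℂ E] [Module Aᵐᵒᵖ E] [IsScalarTower ℂ Aᵐᵒᵖ E]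
    {c : ℂ} (hc : c ≠ 0) {T : Fin 3 → Fin 3 → ℂ → A} (hT : IsTFam c p21 T) (lam : ℂ → ℂ) (Ωd : E)
    {u v : List ℂ} (hu : u.Nodup) (hv : v.Nodup) (au : Adm c u.toFinset) (av : Adm c v.toFinset) :
    Psi c T lam u v Ωd = op (((-1 : ℂ) ^ (v.length * (v.length - 1) / 2)) •
      PsiOp c T lam u.toFinset v.toFinset) • Ωd := by
  rw [Psi, PsiA_eq hc hT lam Ωd hu hv au av, ← smul_assoc, ← op_smul]

/-- first recursion for the dual `Y(2|1)` Bethe vector. -/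
theorem statement12 {E : Type*} [AddCommGroup E] [Module ℂ E] [Module Aᵐᵒᵖ E]
    [IsScalarTower ℂ Aᵐᵒᵖ E]
    (c : ℂ) (hc : c ≠ 0) (T : Fin 3 → Fin 3 → ℂ → A)
    (hT : IsTFam c p21 T) (lam : Fin 3 → ℂ → ℂ) (Ωd : E)
    (hlw0 : ∀ i j : Fin 3, i < j → ∀ z : ℂ, op (T i j z) • Ωd = 0)
    (hlw1 : ∀ i : Fin 3, ∀ z : ℂ, op (T i i z) • Ωd = lam i z • Ωd)
    (u' : List ℂ) (ua : ℂ) (v : List ℂ)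
    (hadm : Admissible c ((u' ++ [ua]) ++ v)) :
    Psi c T (lam 1) (u' ++ [ua]) v Ωd
      = op (T 1 0 ua) • Psi c T (lam 1) u' v Ωd
        + ∑ j : Fin v.length,
            ((-1 : ℂ) ^ (v.length - 1) * lam 1 (v.get j) * gg c (v.get j) ua *
                prodFF c [v.get j] u' * prodGG c (v.eraseIdx (j : ℕ)) [v.get j]) •
              (op (T 2 0 ua) • Psi c T (lam 1) u' (v.eraseIdx (j : ℕ)) Ωd) := by
  have hpw : ∀ x ∈ (u' ++ [ua]) ++ v, ∀ y ∈ (u' ++ [ua]) ++ v, x ≠ y → x - y + c ≠ 0 := by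
    intro x hx y hy hxy
    have hsym : Std.Symm fun x y : ℂ => x ≠ y ∧ x - y + c ≠ 0 ∧ y - x + c ≠ 0 :=
      ⟨fun a b h => ⟨h.1.symm, h.2.2, h.2.1⟩⟩
    exact (List.Pairwise.forall hadm hx hy hxy).2.1
  have hnd : ((u' ++ [ua]) ++ v).Nodup := hadm.imp fun h => h.1
  have hnd1 : (u' ++ [ua]).Nodup := (List.nodup_append.mp hnd).1
  have hndv : v.Nodup := (List.nodup_append.mp hnd).2.1
  have hndu : u'.Nodup := (List.nodup_append.mp hnd1).1
  have hdis : ∀ x ∈ u' ++ [ua], x ∉ v := fun x hx hxv => (List.nodup_append.mp hnd).2.2 x hx x hxv rfl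
  have haU : ua ∉ u'.toFinset := fun h =>
    (List.nodup_append.mp hnd1).2.2 ua (List.mem_toFinset.mp h) ua (by simp) rfl
  have haV : ua ∉ v.toFinset := fun h => hdis ua (by simp) (List.mem_toFinset.mp h)
  have hUV : Disjoint u'.toFinset v.toFinset := by
    rw [Finset.disjoint_left]
    intro x hx hxv
    exact hdis x (by simp [List.mem_toFinset.mp hx]) (List.mem_toFinset.mp hxv)
  have eins : (u' ++ [ua]).toFinset = insert ua u'.toFinset := by
    ext y; simp
  have ad1 : Adm c (u' ++ [ua]).toFinset := fun x hx y hy =>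
    hpw x (List.mem_append_left _ (List.mem_toFinset.mp hx)) y
      (List.mem_append_left _ (List.mem_toFinset.mp hy))
  have adv : Adm c v.toFinset := fun x hx y hy =>
    hpw x (List.mem_append_right _ (List.mem_toFinset.mp hx)) y
      (List.mem_append_right _ (List.mem_toFinset.mp hy))
  have ad1' : Adm c (insert ua u'.toFinset) := eins ▸ ad1
  have adu : Adm c u'.toFinset := ad1'.mono (Finset.subset_insert _ _)
  have hmain := main_op hc hT (lam 1) haU haV hUV ad1'
  have hsum : ∑ j : Fin v.length,
        ((-1 : ℂ) ^ (v.length - 1) * lam 1 (v.get j) * gg c (v.get j) ua *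
          prodFF c [v.get j] u' * prodGG c (v.eraseIdx (j : ℕ)) [v.get j]) •
          (op (T 2 0 ua) • Psi c T (lam 1) u' (v.eraseIdx (j : ℕ)) Ωd) =
      ∑ x ∈ v.toFinset, op (((-1 : ℂ) ^ (v.length * (v.length - 1) / 2)) •
        ((lam 1 x * gg c x ua * (∏ y ∈ u'.toFinset, ff c x y) *
          ∏ q ∈ v.toFinset.erase x, gg c q x) •
          (PsiOp c T (lam 1) u'.toFinset (v.toFinset.erase x) * T 2 0 ua))) • Ωd := by
    rw [toFinset_eq_image v, Finset.sum_image fun a _ b _ h => get_inj hndv h, ← toFinset_eq_image v]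
    refine Finset.sum_congr rfl fun j _ => ?_
    have hperm : (v.eraseIdx (j : ℕ)).toFinset = v.toFinset.erase (v.get j) := by
      have h1 := List.getElem_cons_eraseIdx_perm j.2
      have h2 : (v[(j : ℕ)] :: v.eraseIdx j).Nodup := h1.nodup_iff.mpr hndv
      rw [← List.toFinset_eq_of_perm _ _ h1, List.toFinset_cons]
      refine (Finset.erase_insert ?_).symm
      rw [List.mem_toFinset]
      exact (List.nodup_cons.mp h2).1
    have hnde : (v.eraseIdx (j : ℕ)).Nodup := hndv.sublist (List.eraseIdx_sublist _ _)
    rw [Psi_eq hc hT _ _ hndu hnde adu (hperm ▸ adv.mono (Finset.erase_subset _ _)), hperm,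
      prodFF_eq (by simp) hndu, prodGG_eq hnde (by simp), hperm, smul_smul, ← op_mul, ← smul_assoc,
      ← op_smul]
    have hlen : (v.eraseIdx (j : ℕ)).length = v.length - 1 := List.length_eraseIdx_of_lt j.2
    have hs : (-1 : ℂ) ^ (v.length - 1) * (-1 : ℂ) ^ ((v.length - 1) * (v.length - 1 - 1) / 2) =
        (-1 : ℂ) ^ (v.length * (v.length - 1) / 2) := by
      have : 0 < v.length := j.pos
      obtain ⟨n, hn⟩ : ∃ n, v.length = n + 1 := ⟨v.length - 1, by omega⟩
      rw [hn, ← pow_add, Nat.add_sub_cancel]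
      congr 1
      rcases n with _ | m
      · rfl
      · have : (m + 1 + 1) * (m + 1) = (m + 1) * (m + 1 - 1) + (m + 1) * 2 := by
          simp only [Nat.add_sub_cancel]; ring
        rw [this, Nat.add_mul_div_right _ _ (by norm_num), add_comm]
    rw [← hs, hlen]
    congr 2
    simp only [smul_mul_assoc, smul_smul, PP, List.toFinset_cons, List.toFinset_nil,
      insert_empty_eq, Finset.prod_singleton]
    congr 1
    ring
  rw [hsum, Psi_eq hc hT _ _ hnd1 hndv ad1 adv, Psi_eq hc hT _ _ hndu hndv adu adv, eins, hmain,
    ← Finset.sum_smul, ← Finset.op_sum, smul_smul, ← op_mul, ← add_smul, ← op_add, ← Finset.smul_sum,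
    smul_mul_assoc, smul_add]

end Bethe
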